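/- Let 0 < q₀ < p₀ < ∞ and let f, g be nonnegative measurable functions such that for every A₁ weight w, (∫ f^{p₀} w)^{1/p₀} ≤ C([w]_{A₁}) (∫ g^{q₀} w^{q₀/p₀})^{1/q₀}. Then for all q with q₀ < q < p₀q₀/(p₀ − q₀) and p defined by 1/q − 1/p = 1/q₀ − 1/p₀, one has ‖f‖_{L^p} ≤ C' ‖g‖_{L^q}. -/

import Mathlib

open MeasureTheory Metric
open scoped ENNReal

/-- `w` is an `A₁` weight with constant at most `c`. -/
def IsA1 {n : ℕ} (w : EuclideanSpace ℝ (Fin n) → ℝ≥0∞) (c : ℝ≥0∞) : Prop :=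
  ∀ (x : EuclideanSpace ℝ (Fin n)) (r : ℝ), 0 < r →
    ∀ᵐ y ∂volume.restrict (ball x r),
      (volume (ball x r))⁻¹ * ∫⁻ z in ball x r, w z ≤ c * w y

/-- uncentered Hardy-Littlewood maximal function -/
noncomputable def HLM {n : ℕ} (h : EuclideanSpace ℝ (Fin n) → ℝ≥0∞)
    (x : EuclideanSpace ℝ (Fin n)) : ℝ≥0∞ :=
  ⨆ (z : EuclideanSpace ℝ (Fin n)) (r : ℝ) (_ : x ∈ ball z r),
    (volume (ball z r))⁻¹ * ∫⁻ y in ball z r, h y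

lemma le_HLM {n : ℕ} (h : EuclideanSpace ℝ (Fin n) → ℝ≥0∞) {x z : EuclideanSpace ℝ (Fin n)}
    {r : ℝ} (hx : x ∈ ball z r) :
    (volume (ball z r))⁻¹ * ∫⁻ y in ball z r, h y ≤ HLM h x :=
  le_iSup_of_le z (le_iSup_of_le r (le_iSup_of_le hx le_rfl))

lemma lt_HLM_iff {n : ℕ} (h : EuclideanSpace ℝ (Fin n) → ℝ≥0∞) (x : EuclideanSpace ℝ (Fin n))
    (t : ℝ≥0∞) : t < HLM h x ↔ ∃ (z : EuclideanSpace ℝ (Fin n)) (r : ℝ), x ∈ ball z r ∧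
      t < (volume (ball z r))⁻¹ * ∫⁻ y in ball z r, h y := by
  simp only [HLM, lt_iSup_iff, exists_prop]

lemma measurable_HLM {n : ℕ} (h : EuclideanSpace ℝ (Fin n) → ℝ≥0∞) : Measurable (HLM h) := by
  refine measurable_of_Ioi fun t => IsOpen.measurableSet ?_
  rw [isOpen_iff_mem_nhds]
  intro x hx
  obtain ⟨z, r, hxr, ht⟩ := (lt_HLM_iff h x t).1 hx
  filter_upwards [isOpen_ball.mem_nhds hxr] with y hy
  exact (lt_HLM_iff h y t).2 ⟨z, r, hy, ht⟩

lemma HLM_mono {n : ℕ} {h k : EuclideanSpace ℝ (Fin n) → ℝ≥0∞} (hk : ∀ x, h x ≤ k x)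
    (x : EuclideanSpace ℝ (Fin n)) : HLM h x ≤ HLM k x := by
  unfold HLM
  gcongr
  exact hk _

lemma HLM_add_const {n : ℕ} {h : EuclideanSpace ℝ (Fin n) → ℝ≥0∞} (c : ℝ≥0∞)
    (x : EuclideanSpace ℝ (Fin n)) : HLM (fun y => h y + c) x ≤ HLM h x + c := by
  refine iSup_le fun z => iSup_le fun r => iSup_le fun hx => ?_
  rw [lintegral_add_right _ measurable_const, mul_add]
  gcongr
  · exact le_HLM h hx
  · simp only [lintegral_const, Measure.restrict_apply_univ]
    rw [mul_comm c, ← mul_assoc]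
    calc _ ≤ 1 * c := by gcongr; exact ENNReal.inv_mul_le_one _
      _ = c := one_mul c

lemma HLM_tsum {n : ℕ} {h : ℕ → EuclideanSpace ℝ (Fin n) → ℝ≥0∞} (hm : ∀ k, Measurable (h k))
    (x : EuclideanSpace ℝ (Fin n)) : HLM (fun y => ∑' k, h k y) x ≤ ∑' k, HLM (h k) x := by
  refine iSup_le fun z => iSup_le fun r => iSup_le fun hx => ?_
  rw [lintegral_tsum (fun k => (hm k).aemeasurable), ← ENNReal.tsum_mul_left]
  exact ENNReal.tsum_le_tsum fun k => le_HLM _ hx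

lemma HLM_const_mul {n : ℕ} {h : EuclideanSpace ℝ (Fin n) → ℝ≥0∞} (hm : Measurable h) (c : ℝ≥0∞)
    (x : EuclideanSpace ℝ (Fin n)) : HLM (fun y => c * h y) x ≤ c * HLM h x := by
  refine iSup_le fun z => iSup_le fun r => iSup_le fun hx => ?_
  rw [lintegral_const_mul _ hm, mul_left_comm]
  gcongr
  exact le_HLM h hx

lemma HLM_weak_aux {n : ℕ} (h : EuclideanSpace ℝ (Fin n) → ℝ≥0∞)
    (t : ℝ≥0∞) (R : ℝ) :
    t * volume {x | ∃ (z : EuclideanSpace ℝ (Fin n)) (r : ℝ), r ≤ R ∧ x ∈ ball z r ∧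
      t < (volume (ball z r))⁻¹ * ∫⁻ y in ball z r, h y} ≤ 5 ^ n * ∫⁻ y, h y := by
  set T : Set (EuclideanSpace ℝ (Fin n) × ℝ) := {a | 0 < a.2 ∧ a.2 ≤ R ∧
      t < (volume (ball a.1 a.2))⁻¹ * ∫⁻ y in ball a.1 a.2, h y} with hT
  obtain ⟨u, huT, hdis, hcov⟩ := Vitali.exists_disjoint_subfamily_covering_enlargement_ball T
    (fun a => a.1) (fun a => a.2) R (fun a ha => ha.2.1) 5 (by norm_num)
  have hcount : u.Countable := hdis.countable_of_isOpen (fun _ _ => isOpen_ball)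
    (fun a ha => nonempty_ball.2 (huT ha).1)
  have := hcount.to_subtype
  have hsub : {x | ∃ (z : EuclideanSpace ℝ (Fin n)) (r : ℝ), r ≤ R ∧ x ∈ ball z r ∧
      t < (volume (ball z r))⁻¹ * ∫⁻ y in ball z r, h y} ⊆ ⋃ a : u, ball a.1.1 (5 * a.1.2) := by
    rintro x ⟨z, r, hr, hx, ht⟩
    obtain ⟨b, hb, hbs⟩ := hcov (z, r) ⟨pos_of_mem_ball hx, hr, ht⟩
    exact Set.mem_iUnion.2 ⟨⟨b, hb⟩, hbs hx⟩
  calc _ ≤ t * ∑' a : u, volume (ball a.1.1 (5 * a.1.2)) := by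
        gcongr
        exact (measure_mono hsub).trans (measure_iUnion_le _)
    _ = ∑' a : u, 5 ^ n * (t * volume (ball a.1.1 a.1.2)) := by
        rw [← ENNReal.tsum_mul_left]
        congr 1; ext a
        rw [Measure.addHaar_ball_mul_of_pos _ _ (by norm_num), Measure.addHaar_ball_center _ a.1.1]
        rw [ENNReal.ofReal_pow (by norm_num)]
        simp only [finrank_euclideanSpace, Fintype.card_fin, ENNReal.ofReal_ofNat]
        ring
    _ ≤ ∑' a : u, 5 ^ n * ∫⁻ y in ball a.1.1 a.1.2, h y := by
        refine ENNReal.tsum_le_tsum fun a => ?_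
        gcongr
        have ha := (huT a.2).2.2
        have h0 : volume (ball a.1.1 a.1.2) ≠ 0 := (measure_ball_pos _ _ (huT a.2).1).ne'
        have h1 : volume (ball a.1.1 a.1.2) ≠ ⊤ := measure_ball_lt_top.ne
        calc _ ≤ ((volume (ball a.1.1 a.1.2))⁻¹ * ∫⁻ y in ball a.1.1 a.1.2, h y) *
              volume (ball a.1.1 a.1.2) := by gcongr
          _ = ((volume (ball a.1.1 a.1.2))⁻¹ * volume (ball a.1.1 a.1.2)) *
              ∫⁻ y in ball a.1.1 a.1.2, h y := by ring
          _ = _ := by rw [ENNReal.inv_mul_cancel h0 h1, one_mul]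
    _ = 5 ^ n * ∫⁻ y in ⋃ a : u, ball a.1.1 a.1.2, h y := by
        rw [ENNReal.tsum_mul_left, lintegral_iUnion (fun _ => measurableSet_ball)]
        exact (hdis.subtype _ _)
    _ ≤ _ := by
        gcongr
        exact Measure.restrict_le_self

lemma HLM_weak {n : ℕ} (h : EuclideanSpace ℝ (Fin n) → ℝ≥0∞) (t : ℝ≥0∞) :
    t * volume {x | t < HLM h x} ≤ 5 ^ n * ∫⁻ y, h y := by
  have : {x | t < HLM h x} = ⋃ N : ℕ, {x | ∃ (z : EuclideanSpace ℝ (Fin n)) (r : ℝ),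
      r ≤ (N : ℝ) ∧ x ∈ ball z r ∧ t < (volume (ball z r))⁻¹ * ∫⁻ y in ball z r, h y} := by
    ext x
    simp only [Set.mem_ofPred_eq, Set.mem_iUnion, lt_HLM_iff]
    constructor
    · rintro ⟨z, r, hx, ht⟩
      obtain ⟨N, hN⟩ := exists_nat_ge r
      exact ⟨N, z, r, hN, hx, ht⟩
    · rintro ⟨N, z, r, hN, hx, ht⟩
      exact ⟨z, r, hx, ht⟩
  rw [this, Monotone.measure_iUnion, ENNReal.mul_iSup]
  · exact iSup_le fun N => HLM_weak_aux h t N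
  · rintro N M hNM x ⟨z, r, hN, hx⟩
    exact ⟨z, r, hN.trans (by exact_mod_cast hNM), hx⟩

lemma layer_pt (y : ℝ≥0∞) {s : ℝ} (hs : 0 < s) :
    y ^ s = ENNReal.ofReal s * ∫⁻ t in Set.Ioi (0:ℝ),
      (if ENNReal.ofReal t < y then ENNReal.ofReal (t ^ (s - 1)) else 0) := by
  have key : ∀ a : ℝ, 0 ≤ a → (ENNReal.ofReal a) ^ s = ENNReal.ofReal s * ∫⁻ t in Set.Ioi (0:ℝ),
      (if ENNReal.ofReal t < ENNReal.ofReal a then ENNReal.ofReal (t ^ (s - 1)) else 0) := by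
    intro a ha
    have := lintegral_rpow_eq_lintegral_meas_lt_mul (Measure.dirac ()) (f := fun _ => a)
      (Filter.Eventually.of_forall fun _ => ha) aemeasurable_const hs
    rw [lintegral_dirac] at this
    rw [ENNReal.ofReal_rpow_of_nonneg ha hs.le, this]
    congr 1
    refine setLIntegral_congr_fun measurableSet_Ioi fun t ht => ?_
    have : (ENNReal.ofReal t < ENNReal.ofReal a) ↔ t < a := by
      rw [ENNReal.ofReal_lt_ofReal_iff_of_nonneg (le_of_lt ht)]
    simp only [this]
    by_cases hta : t < a <;> simp [hta]
  by_cases hy : y = ⊤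
  · subst hy
    rw [ENNReal.top_rpow_of_pos hs]
    symm
    rw [← top_le_iff]
    refine ENNReal.le_of_forall_nnreal_lt fun r _ => ?_
    have := key ((r : ℝ) ^ (1 / s)) (by positivity)
    rw [ENNReal.ofReal_rpow_of_nonneg (by positivity) hs.le, ← Real.rpow_mul (by positivity),
      one_div_mul_cancel hs.ne', Real.rpow_one, ENNReal.ofReal_coe_nnreal] at this
    rw [this]
    gcongr with t
    rw [if_pos ENNReal.ofReal_lt_top]
    split_ifs <;> simp
  · rw [← ENNReal.ofReal_toReal hy]
    exact key _ ENNReal.toReal_nonneg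

lemma HLM_trunc {n : ℕ} {h : EuclideanSpace ℝ (Fin n) → ℝ≥0∞} {t : ℝ}
    (ht : 0 < t) :
    ENNReal.ofReal (t / 2) * volume {x | ENNReal.ofReal t < HLM h x} ≤
      5 ^ n * ∫⁻ y, (if ENNReal.ofReal t < 2 * h y then h y else 0) := by
  refine le_trans ?_ (HLM_weak _ (ENNReal.ofReal (t / 2)))
  refine mul_le_mul_right (measure_mono ?_) _
  intro x hx
  rw [Set.mem_ofPred_eq] at hx ⊢
  have h2 : ENNReal.ofReal t = ENNReal.ofReal (t / 2) + ENNReal.ofReal (t / 2) := by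
    rw [← ENNReal.ofReal_add (by positivity) (by positivity)]; simp
  have h1 : HLM h x ≤ HLM (fun y => if ENNReal.ofReal t < 2 * h y then h y else 0) x
      + ENNReal.ofReal (t / 2) := by
    refine le_trans (HLM_mono (fun y => ?_) x) (HLM_add_const _ x)
    split_ifs with hy
    · exact le_self_add
    · rw [not_lt, h2, ← two_mul, ENNReal.mul_le_mul_iff_right (by simp) (by simp)] at hy
      simpa using hy
  have h3 := h2.symm.trans_lt (hx.trans_le h1)
  exact (ENNReal.add_lt_add_iff_right ENNReal.ofReal_ne_top).1 h3

lemma HLM_strong (n : ℕ) {s : ℝ} (hs : 1 < s) : ∃ A : ℝ≥0∞, A < ⊤ ∧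
    ∀ h : EuclideanSpace ℝ (Fin n) → ℝ≥0∞, Measurable h →
      ∫⁻ x, HLM h x ^ s ≤ A * ∫⁻ x, h x ^ s := by
  have hs0 : 0 < s := by linarith
  have hs1 : 0 < s - 1 := by linarith
  refine ⟨ENNReal.ofReal s * (5 ^ n * 2 * ((ENNReal.ofReal (s - 1))⁻¹ * 2 ^ (s - 1))), ?_, ?_⟩
  · refine ENNReal.mul_lt_top ENNReal.ofReal_lt_top (ENNReal.mul_lt_top (ENNReal.mul_lt_top ?_ ?_)
      (ENNReal.mul_lt_top ?_ ?_))
    · exact ENNReal.pow_lt_top (by simp)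
    · simp
    · simp [hs]
    · exact ENNReal.rpow_lt_top_of_nonneg hs1.le (by simp)
  intro h hm
  have hMm := measurable_HLM h
  have m1 : Measurable (Function.uncurry fun (x : EuclideanSpace ℝ (Fin n)) (t : ℝ) =>
      (if ENNReal.ofReal t < HLM h x then ENNReal.ofReal (t ^ (s - 1)) else 0)) := by
    refine Measurable.ite (measurableSet_lt (by fun_prop) (by fun_prop)) (by fun_prop) (by fun_prop)
  have m2 : Measurable (Function.uncurry fun (x : EuclideanSpace ℝ (Fin n)) (t : ℝ) =>
      (if ENNReal.ofReal t < 2 * h x then ENNReal.ofReal (t ^ (s - 1 - 1)) else 0) * h x) := by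
    refine Measurable.mul (Measurable.ite (measurableSet_lt (by fun_prop) (by fun_prop))
      (by fun_prop) (by fun_prop)) (by fun_prop)
  calc ∫⁻ x, HLM h x ^ s
      = ENNReal.ofReal s * ∫⁻ x, ∫⁻ t in Set.Ioi (0:ℝ),
        (if ENNReal.ofReal t < HLM h x then ENNReal.ofReal (t ^ (s - 1)) else 0) := by
        rw [← lintegral_const_mul' _ _ ENNReal.ofReal_ne_top]
        exact lintegral_congr fun x => layer_pt _ hs0
    _ = ENNReal.ofReal s * ∫⁻ t in Set.Ioi (0:ℝ), ∫⁻ x,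
        (if ENNReal.ofReal t < HLM h x then ENNReal.ofReal (t ^ (s - 1)) else 0) := by
        rw [lintegral_lintegral_swap m1.aemeasurable]
    _ ≤ ENNReal.ofReal s * ∫⁻ t in Set.Ioi (0:ℝ), 5 ^ n * 2 * ∫⁻ x,
        (if ENNReal.ofReal t < 2 * h x then ENNReal.ofReal (t ^ (s - 1 - 1)) else 0) * h x := by
        gcongr ENNReal.ofReal s * ?_
        refine setLIntegral_mono' measurableSet_Ioi fun t ht => ?_
        have ht : 0 < t := ht
        have e1 : ∫⁻ x, (if ENNReal.ofReal t < HLM h x then ENNReal.ofReal (t ^ (s - 1)) else 0)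
            = ENNReal.ofReal (t ^ (s - 1)) * volume {x | ENNReal.ofReal t < HLM h x} := by
          rw [← lintegral_indicator_const (measurableSet_lt measurable_const hMm)]
          refine lintegral_congr fun x => ?_
          simp [Set.indicator_apply]
        have e2 : ∫⁻ x, (if ENNReal.ofReal t < 2 * h x then ENNReal.ofReal (t ^ (s - 1 - 1)) else 0)
              * h x = ENNReal.ofReal (t ^ (s - 1 - 1)) *
              ∫⁻ x, (if ENNReal.ofReal t < 2 * h x then h x else 0) := by
          rw [← lintegral_const_mul' _ _ ENNReal.ofReal_ne_top]
          refine lintegral_congr fun x => ?_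
          split_ifs <;> simp
        have e3 : ENNReal.ofReal (t ^ (s - 1)) =
            2 * ENNReal.ofReal (t ^ (s - 1 - 1)) * ENNReal.ofReal (t / 2) := by
          rw [← ENNReal.ofReal_ofNat 2, ← ENNReal.ofReal_mul (by norm_num),
            ← ENNReal.ofReal_mul (by positivity)]
          congr 1
          rw [Real.rpow_sub_one ht.ne' (s - 1)]
          field_simp
        rw [e1, e2, e3, mul_assoc]
        calc _ ≤ 2 * ENNReal.ofReal (t ^ (s - 1 - 1)) *
              (5 ^ n * ∫⁻ y, (if ENNReal.ofReal t < 2 * h y then h y else 0)) := by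
              exact mul_le_mul_right (HLM_trunc ht) _
          _ = _ := by ring
    _ = ENNReal.ofReal s * (5 ^ n * 2 * ∫⁻ x, ∫⁻ t in Set.Ioi (0:ℝ),
        (if ENNReal.ofReal t < 2 * h x then ENNReal.ofReal (t ^ (s - 1 - 1)) else 0) * h x) := by
        rw [lintegral_const_mul' _ _ (ENNReal.mul_ne_top (ENNReal.pow_ne_top (by simp)) (by simp)),
          lintegral_lintegral_swap m2.aemeasurable]
    _ = ENNReal.ofReal s * (5 ^ n * 2 * ∫⁻ x,
          ((ENNReal.ofReal (s - 1))⁻¹ * 2 ^ (s - 1)) * h x ^ s) := by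
        congr 3
        ext x
        have m3 : Measurable fun t : ℝ => (if ENNReal.ofReal t < 2 * h x then
            ENNReal.ofReal (t ^ (s - 1 - 1)) else 0) :=
          Measurable.ite (measurableSet_lt (by fun_prop) (by fun_prop)) (by fun_prop) (by fun_prop)
        rw [lintegral_mul_const _ m3]
        have e := layer_pt (2 * h x) hs1
        have hne : ENNReal.ofReal (s - 1) ≠ 0 := by simpa using hs
        rw [← ENNReal.inv_mul_cancel_left hne ENNReal.ofReal_ne_top
          (b := ∫⁻ t in Set.Ioi (0:ℝ), (if ENNReal.ofReal t < 2 * h x then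
            ENNReal.ofReal (t ^ (s - 1 - 1)) else 0)), ← e,
          ENNReal.mul_rpow_of_nonneg _ _ hs1.le]
        have : h x ^ s = h x ^ (s - 1) * h x := by
          conv_rhs => rw [← ENNReal.rpow_one (h x), ← ENNReal.rpow_mul, one_mul]
          rw [← ENNReal.rpow_add_of_nonneg _ _ hs1.le zero_le_one]
          simp
        rw [this]; ring
    _ = _ := by
        rw [lintegral_const_mul _ (by fun_prop)]; ring

lemma rdf (n : ℕ) {s : ℝ} (hs : 1 < s) : ∃ c : ℝ≥0∞, c < ⊤ ∧
    ∀ h : EuclideanSpace ℝ (Fin n) → ℝ≥0∞, Measurable h →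
      ∃ w : EuclideanSpace ℝ (Fin n) → ℝ≥0∞, Measurable w ∧ (∀ x, h x ≤ w x) ∧ IsA1 w c ∧
        (∫⁻ x, w x ^ s) ^ (1 / s) ≤ 2 * (∫⁻ x, h x ^ s) ^ (1 / s) := by
  obtain ⟨A, hA, hM⟩ := HLM_strong n hs
  have hs0 : 0 < s := by linarith
  have his : 0 ≤ 1 / s := by positivity
  set B : ℝ≥0∞ := A ^ (1 / s) + 1 with hB
  have hBt : B < ⊤ := ENNReal.add_lt_top.2 ⟨ENNReal.rpow_lt_top_of_nonneg his hA.ne, by simp⟩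
  have hB0 : B ≠ 0 := by simp [hB]
  have h2B0 : 2 * B ≠ 0 := by simp [hB0]
  have h2Bt : 2 * B ≠ ⊤ := ENNReal.mul_ne_top (by simp) hBt.ne
  refine ⟨2 * B, h2Bt.lt_top, fun h hm => ?_⟩
  let v : ℕ → EuclideanSpace ℝ (Fin n) → ℝ≥0∞ :=
    fun k => Nat.rec h (fun _ u x => (2 * B)⁻¹ * HLM u x) k
  have hv0 : v 0 = h := rfl
  have hvs : ∀ k, v (k + 1) = fun x => (2 * B)⁻¹ * HLM (v k) x := fun k => rfl
  have hvm : ∀ k, Measurable (v k) := by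
    intro k
    cases k with
    | zero => exact hm
    | succ k => rw [hvs]; exact (measurable_HLM _).const_mul _
  have hHv : ∀ k x, HLM (v k) x = 2 * B * v (k + 1) x := by
    intro k x
    rw [hvs, ENNReal.mul_inv_cancel_left h2B0 h2Bt]
  set Nm := (∫⁻ x, h x ^ s) ^ (1 / s) with hNm
  have hvn : ∀ k, (∫⁻ x, v k x ^ s) ^ (1 / s) ≤ 2⁻¹ ^ k * Nm := by
    intro k
    induction k with
    | zero => simp [hv0, hNm]
    | succ k ih =>
      have : ∫⁻ x, v (k + 1) x ^ s = ((2 * B)⁻¹) ^ s * ∫⁻ x, HLM (v k) x ^ s := by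
        rw [← lintegral_const_mul _ ((measurable_HLM _).pow_const _)]
        refine lintegral_congr fun x => ?_
        rw [hvs, ENNReal.mul_rpow_of_nonneg _ _ hs0.le]
      rw [this, ENNReal.mul_rpow_of_nonneg _ _ his, ← ENNReal.rpow_mul, mul_one_div_cancel hs0.ne',
        ENNReal.rpow_one]
      calc _ ≤ (2 * B)⁻¹ * (A * ∫⁻ x, v k x ^ s) ^ (1 / s) := by
            gcongr; exact hM _ (hvm k)
        _ = (2 * B)⁻¹ * (A ^ (1 / s) * (∫⁻ x, v k x ^ s) ^ (1 / s)) := by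
            rw [ENNReal.mul_rpow_of_nonneg _ _ his]
        _ ≤ (2 * B)⁻¹ * (B * (2⁻¹ ^ k * Nm)) := by
            gcongr; exact le_self_add
        _ = _ := by
            rw [ENNReal.mul_inv (by simp) (by simp), pow_succ]
            calc _ = (B⁻¹ * B) * (2⁻¹ ^ k * 2⁻¹ * Nm) := by ring
              _ = _ := by rw [ENNReal.inv_mul_cancel hB0 hBt.ne, one_mul]
  have hSm : ∀ N, Measurable fun x => ∑ k ∈ Finset.range N, v k x := fun N =>
    Finset.measurable_fun_sum _ fun k _ => hvm k
  have hSn : ∀ N, (∫⁻ x, (∑ k ∈ Finset.range N, v k x) ^ s) ^ (1 / s) ≤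
      ∑ k ∈ Finset.range N, 2⁻¹ ^ k * Nm := by
    intro N
    induction N with
    | zero => simp [hs0]
    | succ N ih =>
      simp only [Finset.sum_range_succ]
      refine (ENNReal.lintegral_Lp_add_le (hSm N).aemeasurable (hvm N).aemeasurable hs.le).trans ?_
      exact add_le_add ih (hvn N)
  have hSn2 : ∀ N, ∫⁻ x, (∑ k ∈ Finset.range N, v k x) ^ s ≤ (2 * Nm) ^ s := by
    intro N
    rw [← ENNReal.rpow_inv_le_iff hs0, ← one_div]
    refine (hSn N).trans ?_
    rw [← Finset.sum_mul]
    gcongr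
    refine (ENNReal.sum_le_tsum _).trans ?_
    rw [ENNReal.tsum_geometric]
    simp [ENNReal.one_sub_inv_two]
  refine ⟨fun x => ∑' k, v k x, Measurable.tsum hvm, fun x => ?_, ?_, ?_⟩
  · exact ENNReal.le_tsum (f := fun k => v k x) 0
  · intro x r hr
    filter_upwards [ae_restrict_mem measurableSet_ball] with y hy
    refine (le_HLM _ hy).trans ((HLM_tsum hvm y).trans ?_)
    simp only [hHv, ENNReal.tsum_mul_left]
    exact mul_le_mul_right
      (ENNReal.tsum_comp_le_tsum_of_injective (add_left_injective 1) (fun k => v k y)) _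
  · rw [one_div, ENNReal.rpow_inv_le_iff hs0]
    have hl : Filter.Tendsto (fun N => ∫⁻ x, (∑ k ∈ Finset.range N, v k x) ^ s) Filter.atTop
        (nhds (∫⁻ x, (∑' k, v k x) ^ s)) := by
      refine lintegral_tendsto_of_tendsto_of_monotone (fun N => ((hSm N).pow_const _).aemeasurable)
        (Filter.Eventually.of_forall fun x => ?_) (Filter.Eventually.of_forall fun x => ?_)
      · intro N M hNM
        dsimp only
        gcongr
      · exact (ENNReal.continuous_rpow_const.tendsto _).comp
          (ENNReal.tendsto_nat_tsum (fun k => v k x))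
    exact le_of_tendsto' hl hSn2

/-- Off-diagonal Rubio de Francia extrapolation (unmixed case of Theorem 5.3). -/
theorem stmt15 (n : ℕ) (hn : 0 < n) (q₀ p₀ : ℝ) (hq₀ : 0 < q₀) (hq₀p₀ : q₀ < p₀)
    (Cfun : ℝ≥0∞ → ℝ≥0∞) (hCfun : ∀ c, c < ⊤ → Cfun c < ⊤)
    (q p : ℝ) (hq : q₀ < q) (hq' : q < p₀ * q₀ / (p₀ - q₀))
    (hp : 1 / q - 1 / p = 1 / q₀ - 1 / p₀) :
    ∃ C' : ℝ≥0∞, C' < ⊤ ∧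
      ∀ f g : EuclideanSpace ℝ (Fin n) → ℝ≥0∞, Measurable f → Measurable g →
        (∀ (w : EuclideanSpace ℝ (Fin n) → ℝ≥0∞) (c : ℝ≥0∞), Measurable w →
          LocallyIntegrable (fun x => (w x).toReal) volume → IsA1 w c →
          (∫⁻ x, f x ^ p₀ * w x) ^ (1 / p₀) ≤
            Cfun c * (∫⁻ x, g x ^ q₀ * w x ^ (q₀ / p₀)) ^ (1 / q₀)) →
        (∫⁻ x, f x ^ p) ^ (1 / p) ≤ C' * (∫⁻ x, g x ^ q) ^ (1 / q) := by
  have hp₀ : 0 < p₀ := hq₀.trans hq₀p₀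
  have hq0 : 0 < q := hq₀.trans hq
  have hd : 0 < p₀ - q₀ := by linarith
  have hip : 0 < 1 / p := by
    have h1 : 1 / p = 1 / q - (1 / q₀ - 1 / p₀) := by linarith
    rw [h1, sub_pos]
    have h2 : 1 / q₀ - 1 / p₀ = 1 / (p₀ * q₀ / (p₀ - q₀)) := by field_simp
    rw [h2]
    exact one_div_lt_one_div_of_lt hq0 hq'
  have hp0 : 0 < p := one_div_pos.1 hip
  have hpp : p₀ < p := by
    have h1 : 1 / q < 1 / q₀ := one_div_lt_one_div_of_lt hq₀ hq
    exact (one_div_lt_one_div hp0 hp₀).1 (by linarith)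
  have hdp : 0 < p - p₀ := by linarith
  have hdq : 0 < q - q₀ := by linarith
  set s : ℝ := p / (p - p₀) with hs_def
  have hs : 1 < s := by rw [hs_def, one_lt_div hdp]; linarith
  have hs0 : 0 < s := by linarith
  have his : 1 / s * (1 / p₀) = 1 / p₀ - 1 / p := by rw [hs_def]; field_simp
  have hqs : q₀ / p₀ * (q / (q - q₀)) = s := by
    have h1 : 1 / s * (1 / p₀) = 1 / q₀ - 1 / q := by rw [his]; linarith
    have h2 : 1 / q₀ - 1 / q = (q - q₀) / (q₀ * q) := by field_simp
    rw [h2] at h1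
    field_simp at h1 ⊢
    linarith
  obtain ⟨c, hc, hR⟩ := rdf n hs
  refine ⟨Cfun c * 2 ^ (1 / p₀), ENNReal.mul_lt_top (hCfun c hc)
    (ENNReal.rpow_lt_top_of_nonneg (by positivity) (by simp)), ?_⟩
  intro f g hf hg H
  set G : ℝ≥0∞ := (∫⁻ x, g x ^ q) ^ (1 / q) with hG
  let F : ℕ → EuclideanSpace ℝ (Fin n) → ℝ≥0∞ :=
    fun N => (ball 0 (N : ℝ)).indicator (fun x => min (f x) N)
  have hFm : ∀ N, Measurable (F N) := fun N =>
    (hf.min measurable_const).indicator measurableSet_ball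
  have hFf : ∀ N x, F N x ≤ f x := fun N x =>
    Set.indicator_apply_le' (fun _ => min_le_left _ _) (fun _ => zero_le)
  have main : ∀ N, ∫⁻ x, F N x ^ p ≤ (Cfun c * 2 ^ (1 / p₀) * G) ^ p := by
    intro N
    set A : ℝ≥0∞ := ∫⁻ x, F N x ^ p with hA
    have hAt : A ≠ ⊤ := by
      have : A ≤ ∫⁻ x in ball (0 : EuclideanSpace ℝ (Fin n)) (N : ℝ), (N : ℝ≥0∞) ^ p := by
        rw [← lintegral_indicator measurableSet_ball]
        refine lintegral_mono fun x => ?_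
        by_cases hx : x ∈ ball (0 : EuclideanSpace ℝ (Fin n)) (N : ℝ)
        · simp only [F, Set.indicator_of_mem hx]
          gcongr
          exact min_le_right _ _
        · simp only [F, Set.indicator_of_notMem hx]
          simp [hp0]
      refine ne_top_of_le_ne_top ?_ this
      rw [setLIntegral_const]
      exact ENNReal.mul_ne_top (ENNReal.rpow_ne_top_of_nonneg hp0.le (by simp))
        measure_ball_lt_top.ne
    rcases eq_or_ne A 0 with hA0 | hA0
    · rw [hA0]; exact zero_le
    obtain ⟨w, hwm, hFw, hw1, hwn⟩ := hR (fun x => F N x ^ (p - p₀)) ((hFm N).pow_const _)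
    have hhA : ∫⁻ x, (F N x ^ (p - p₀)) ^ s = A := by
      refine lintegral_congr fun x => ?_
      rw [← ENNReal.rpow_mul, hs_def, mul_div_cancel₀ _ hdp.ne']
    rw [hhA] at hwn
    have hws : ∫⁻ x, w x ^ s ≠ ⊤ := by
      intro h
      rw [h, ENNReal.top_rpow_of_pos (by positivity), top_le_iff] at hwn
      exact ENNReal.mul_ne_top (by simp) (ENNReal.rpow_ne_top_of_nonneg (by positivity) hAt) hwn
    have hloc : LocallyIntegrable (fun x => (w x).toReal) volume := by
      rw [locallyIntegrable_iff]
      intro k hk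
      refine integrable_toReal_of_lintegral_ne_top hwm.aemeasurable ?_
      have : ∫⁻ x in k, w x ≤ ∫⁻ x in k, (1 + w x ^ s) := by
        refine lintegral_mono fun x => ?_
        rcases le_total (w x) 1 with h1 | h1
        · exact h1.trans le_self_add
        · calc w x = w x ^ (1 : ℝ) := (ENNReal.rpow_one _).symm
            _ ≤ w x ^ s := ENNReal.rpow_le_rpow_of_exponent_le h1 hs.le
            _ ≤ _ := le_add_self
      refine ne_top_of_le_ne_top ?_ this
      rw [lintegral_add_left measurable_const]
      refine ENNReal.add_ne_top.2 ⟨?_, ne_top_of_le_ne_top hws (setLIntegral_le_lintegral _ _)⟩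
      simpa using hk.measure_ne_top
    have h1 := H w c hwm hloc hw1
    have h2 : A ≤ ∫⁻ x, f x ^ p₀ * w x := by
      refine lintegral_mono fun x => ?_
      calc F N x ^ p = F N x ^ p₀ * F N x ^ (p - p₀) := by
            rw [← ENNReal.rpow_add_of_nonneg _ _ hp₀.le hdp.le]; congr 1; ring
        _ ≤ _ := by
          gcongr
          · exact hFf N x
          · exact hFw x
    have hconj : (q / q₀).HolderConjugate (q / (q - q₀)) := by
      rw [Real.holderConjugate_iff]
      refine ⟨by rwa [one_lt_div hq₀], by field_simp; ring⟩
    have h3 : (∫⁻ x, g x ^ q₀ * w x ^ (q₀ / p₀)) ^ (1 / q₀) ≤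
        G * ((∫⁻ x, w x ^ s) ^ (1 / s)) ^ (1 / p₀) := by
      have := ENNReal.lintegral_mul_le_Lp_mul_Lq volume hconj (hg.pow_const q₀).aemeasurable
        (hwm.pow_const (q₀ / p₀)).aemeasurable
      simp only [Pi.mul_apply, ← ENNReal.rpow_mul, hqs, mul_div_cancel₀ _ hq₀.ne'] at this
      calc _ ≤ ((∫⁻ x, g x ^ q) ^ (1 / (q / q₀)) *
            (∫⁻ x, w x ^ s) ^ (1 / (q / (q - q₀)))) ^ (1 / q₀) := by gcongr
        _ = _ := by
          rw [ENNReal.mul_rpow_of_nonneg _ _ (by positivity), ← ENNReal.rpow_mul,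
            ← ENNReal.rpow_mul, ← ENNReal.rpow_mul, hG]
          congr 2
          · field_simp
          · rw [← hqs]; field_simp
    have h4 : A ^ (1 / p₀) ≤ Cfun c * 2 ^ (1 / p₀) * G * A ^ (1 / s * (1 / p₀)) := by
      calc A ^ (1 / p₀) ≤ (∫⁻ x, f x ^ p₀ * w x) ^ (1 / p₀) := by gcongr
        _ ≤ Cfun c * (G * ((∫⁻ x, w x ^ s) ^ (1 / s)) ^ (1 / p₀)) :=
          h1.trans (mul_le_mul_right h3 _)
        _ ≤ Cfun c * (G * (2 * A ^ (1 / s)) ^ (1 / p₀)) := by gcongr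
        _ = _ := by
          rw [ENNReal.mul_rpow_of_nonneg _ _ (by positivity), ENNReal.rpow_mul]; ring
    have h5 : A ^ (1 / p₀) = A ^ (1 / p) * A ^ (1 / s * (1 / p₀)) := by
      rw [← ENNReal.rpow_add _ _ hA0 hAt, his]; congr 1; ring
    rw [h5] at h4
    have h6 := (ENNReal.mul_le_mul_iff_left (by simp [hA0, hAt])
      (ENNReal.rpow_ne_top_of_nonneg (by positivity) hAt)).1 h4
    rwa [one_div, ENNReal.rpow_inv_le_iff hp0] at h6
  rw [one_div p, ENNReal.rpow_inv_le_iff hp0]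
  have hl : Filter.Tendsto (fun N => ∫⁻ x, F N x ^ p) Filter.atTop (nhds (∫⁻ x, f x ^ p)) := by
    refine lintegral_tendsto_of_tendsto_of_monotone (fun N => ((hFm N).pow_const _).aemeasurable)
      (Filter.Eventually.of_forall fun x => ?_) (Filter.Eventually.of_forall fun x => ?_)
    · intro N M hNM
      have hNM' : (N : ℝ) ≤ M := by exact_mod_cast hNM
      have hNM2 : (N : ℝ≥0∞) ≤ M := by exact_mod_cast hNM
      refine ENNReal.rpow_le_rpow ?_ hp0.le
      by_cases hx : x ∈ ball (0 : EuclideanSpace ℝ (Fin n)) (N : ℝ)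
      · simp only [F, Set.indicator_of_mem hx, Set.indicator_of_mem (ball_subset_ball hNM' hx)]
        exact min_le_min_left _ hNM2
      · simp only [F, Set.indicator_of_notMem hx]
        exact zero_le
    · refine (ENNReal.continuous_rpow_const.tendsto _).comp ?_
      have h1 : Filter.Tendsto (fun N : ℕ => min (f x) (N : ℝ≥0∞)) Filter.atTop
          (nhds (min (f x) ⊤)) := tendsto_const_nhds.min ENNReal.tendsto_nat_nhds_top
      rw [min_top_right] at h1
      refine h1.congr' ?_
      obtain ⟨N₀, hN₀⟩ := exists_nat_gt ‖x‖
      filter_upwards [Filter.eventually_ge_atTop N₀] with N hN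
      have : x ∈ ball (0 : EuclideanSpace ℝ (Fin n)) (N : ℝ) := by
        rw [mem_ball_zero_iff]
        exact hN₀.trans_le (by exact_mod_cast hN)
      simp only [F, Set.indicator_of_mem this]
  exact le_of_tendsto' hl main
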